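/- arXiv:1812.09771 — 5 statements merged into one kernel-verified Lean document; each statement's English description precedes it below -/
import Mathlib

section
/- Let X be a real N×d matrix, 1 ≤ k < d, θ > 1, π a permutation of {1,…,d} ordering the k-leverage scores decreasingly, and q an integer with k ≤ q ≤ d such that ∑_{i=1}^q ℓ_{π(i)} ≥ k − 1 + 1/θ. Let Q = {π(1),…,π(q)}. Then the probability under the projection DPP that the sampled size-k subset S is contained in Q (equivalently, avoids the d−q columns with smallest k-leverage scores) satisfies ∑_{S⊆Q, |S|=k} det(V_{S,[k]})² ≥ 1/θ. -/
open Matrix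

/-- The increasing enumeration of a size-`k` subset of `Fin d`. -/
def rowEnum {d k : ℕ} (S : {S : Finset (Fin d) // S.card = k}) : Fin k → Fin d :=
  fun i => ((S.1.orderIsoOfFin S.2) i).1

/-- `det(V_{S,[k]})²`, the projection DPP probability of the size-`k` subset `S`. -/
noncomputable def detSq {d : ℕ} (V : Matrix (Fin d) (Fin d) ℝ) {k : ℕ} (hkd : k ≤ d)
    (S : {S : Finset (Fin d) // S.card = k}) : ℝ :=
  (V.submatrix (rowEnum S) (Fin.castLE hkd)).det ^ 2

/-- The `k`-leverage score of column `i`: `ℓ_i = ∑_{j=1}^k V_{i,j}²`. -/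
noncomputable def lev {d : ℕ} (V : Matrix (Fin d) (Fin d) ℝ) (k : ℕ) (hkd : k ≤ d)
    (i : Fin d) : ℝ :=
  ∑ j : Fin k, V i (Fin.castLE hkd j) ^ 2

/-- The Cauchy–Binet formula. -/
theorem Matrix.det_mul_eq_sum_rowEnum {R : Type*} [CommRing R] {d k : ℕ}
    (A : Matrix (Fin k) (Fin d) R) (B : Matrix (Fin d) (Fin k) R) :
    (A * B).det = ∑ S : {S : Finset (Fin d) // S.card = k},
      (A.submatrix id (rowEnum S)).det * (B.submatrix (rowEnum S) id).det := by
  have rowEnum_injective (S : {S : Finset (Fin d) // S.card = k}) :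
      Function.Injective (rowEnum S) := fun i j h =>
    (S.1.orderIsoOfFin S.2).injective (Subtype.ext h)
  have range_rowEnum (S : {S : Finset (Fin d) // S.card = k}) :
      Set.range (rowEnum S) = (S.1 : Set (Fin d)) := by
    ext x
    constructor
    · rintro ⟨i, rfl⟩
      exact ((S.1.orderIsoOfFin S.2) i).2
    · intro hx
      exact ⟨(S.1.orderIsoOfFin S.2).symm ⟨x, hx⟩, by simp [rowEnum]⟩
  have expand : (A * B).det =
      ∑ p : Fin k → Fin d, (∏ i, A i (p i)) * (B.submatrix p id).det := by
    have hrow : A * B = fun i => ∑ j, A i j • B j := by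
      ext i j
      simp [Matrix.mul_apply, Finset.sum_apply]
    rw [hrow]
    change Matrix.detRowAlternating.toMultilinearMap (fun i => ∑ j, A i j • B j) = _
    rw [MultilinearMap.map_sum]
    refine Finset.sum_congr rfl fun p _ => ?_
    rw [MultilinearMap.map_smul_univ]
    rfl
  have factor (S : {S : Finset (Fin d) // S.card = k}) :
      (A.submatrix id (rowEnum S)).det * (B.submatrix (rowEnum S) id).det =
        ∑ τ : Equiv.Perm (Fin k), (∏ i, A i (rowEnum S (τ i))) *
          (B.submatrix (rowEnum S ∘ τ) id).det := by
    rw [← Matrix.det_transpose (A.submatrix id (rowEnum S)), Matrix.det_apply', Finset.sum_mul]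
    refine Finset.sum_congr rfl fun τ _ => ?_
    have hB : (B.submatrix (rowEnum S ∘ τ) id).det =
        (Equiv.Perm.sign τ : ℤ) * (B.submatrix (rowEnum S) id).det :=
      Matrix.det_permute τ (B.submatrix (rowEnum S) id)
    rw [hB]
    simp only [transpose_apply, submatrix_apply, id_eq]
    ring
  simp_rw [factor]
  rw [expand, ← Fintype.sum_prod_type', eq_comm]
  refine Finset.sum_of_injOn (fun x => rowEnum x.1 ∘ x.2) ?_ (by simp) ?_ (fun _ _ => rfl)
  · rintro ⟨S, τ⟩ - ⟨S', τ'⟩ - h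
    have h : rowEnum S ∘ τ = rowEnum S' ∘ τ' := h
    have hS : S = S' := by
      have hr := congrArg Set.range h
      rw [EquivLike.range_comp, EquivLike.range_comp, range_rowEnum, range_rowEnum] at hr
      exact Subtype.ext (Finset.coe_injective hr)
    subst hS
    have hτ : τ = τ' := Equiv.ext fun i => rowEnum_injective S (congrFun h i)
    rw [hτ]
  · intro p _ hp
    have hni : ¬ Function.Injective p := by
      intro hinj
      refine hp ?_
      let S : {S : Finset (Fin d) // S.card = k} :=
        ⟨Finset.univ.image p, by simp [Finset.card_image_of_injective _ hinj]⟩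
      have hmem (i : Fin k) : ∃ j, rowEnum S j = p i := by
        have : p i ∈ Set.range (rowEnum S) := by
          rw [range_rowEnum]
          simp [S]
        exact this
      choose f hf using hmem
      have hfinj : Function.Injective f := fun i j hij => hinj (by rw [← hf, ← hf, hij])
      exact ⟨(S, Equiv.ofBijective f (Finite.injective_iff_bijective.mp hfinj)), by simp,
        funext hf⟩
    simp only [Function.Injective, not_forall] at hni
    obtain ⟨i, j, hij, hne⟩ := hni
    rw [Matrix.det_zero_of_row_eq hne (by ext; simp [hij]), mul_zero]

/-- The Gram determinant of the rows in `Q` is the sum of the squared maximal minors of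
these rows. -/
theorem Matrix.det_transpose_mul_diagonal_mul {d k : ℕ} (W : Matrix (Fin d) (Fin k) ℝ)
    (Q : Finset (Fin d)) :
    (Wᵀ * diagonal (fun i => if i ∈ Q then (1 : ℝ) else 0) * W).det =
      ∑ S ∈ Finset.univ.filter (fun S : {S : Finset (Fin d) // S.card = k} => S.1 ⊆ Q),
        (W.submatrix (rowEnum S) id).det ^ 2 := by
  rw [Matrix.det_mul_eq_sum_rowEnum, Finset.sum_filter]
  refine Finset.sum_congr rfl fun S _ => ?_
  split_ifs with h
  · rw [sq]
    congr 1
    rw [← Matrix.det_transpose (W.submatrix (rowEnum S) id)]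
    congr 1
    ext i j
    have hj : rowEnum S j ∈ Q := h ((S.1.orderIsoOfFin S.2) j).2
    simp [hj]
  · obtain ⟨x, hxS, hxQ⟩ := Finset.not_subset.mp h
    have hx : rowEnum S ((S.1.orderIsoOfFin S.2).symm ⟨x, hxS⟩) = x := by simp [rowEnum]
    rw [Matrix.det_eq_zero_of_column_eq_zero ((S.1.orderIsoOfFin S.2).symm ⟨x, hxS⟩), zero_mul]
    intro i
    simp [hx, hxQ]

theorem Finset.sum_sub_card_add_one_le_prod {ι : Type*} (s : Finset ι) (x : ι → ℝ)
    (h0 : ∀ i, 0 ≤ x i) (h1 : ∀ i, x i ≤ 1) :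
    ∑ i ∈ s, x i - s.card + 1 ≤ ∏ i ∈ s, x i := by
  classical
  induction s using Finset.induction_on with
  | empty => simp
  | insert a s ha ih =>
    have hP : ∏ i ∈ s, x i ≤ 1 := Finset.prod_le_one (fun i _ => h0 i) (fun i _ => h1 i)
    rw [Finset.sum_insert ha, Finset.prod_insert ha, Finset.card_insert_of_notMem ha]
    push_cast
    nlinarith [mul_nonneg (sub_nonneg.mpr (h1 a)) (sub_nonneg.mpr hP)]

/-- A matrix `0 ≤ G ≤ 1` satisfies `tr G - (n - 1) ≤ det G`. -/
theorem Matrix.PosSemidef.trace_sub_card_add_one_le_det {n : Type*} [Fintype n] [DecidableEq n]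
    {G : Matrix n n ℝ} (hG : G.PosSemidef) (hG1 : (1 - G).PosSemidef) :
    G.trace - Fintype.card n + 1 ≤ G.det := by
  rw [hG.1.trace_eq_sum_eigenvalues, hG.1.det_eq_prod_eigenvalues]
  refine Finset.sum_sub_card_add_one_le_prod Finset.univ hG.1.eigenvalues hG.eigenvalues_nonneg
    fun i => ?_
  have hv := hG.1.mulVec_eigenvectorBasis i
  set v := hG.1.eigenvectorBasis i with hvdef
  have hn : v.ofLp ⬝ᵥ v.ofLp = 1 := by
    have h : inner ℝ v v = 1 := by
      rw [real_inner_self_eq_norm_sq, hvdef, hG.1.eigenvectorBasis.orthonormal.1 i, one_pow]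
    rw [← h, EuclideanSpace.inner_eq_star_dotProduct]
    simp
  have h := hG1.re_dotProduct_nonneg v.ofLp
  rw [sub_mulVec, one_mulVec, hv, dotProduct_sub, dotProduct_smul] at h
  simp [hn] at h
  exact h

theorem dpp_avoiding_probability {N d k : ℕ} (hN : 0 < N) (hk : 1 ≤ k) (hkd : k < d)
    (X : Matrix (Fin N) (Fin d) ℝ) (V : Matrix (Fin d) (Fin d) ℝ) (σ : Fin d → ℝ)
    (hV : Vᵀ * V = 1) (hσ0 : ∀ i, 0 ≤ σ i) (hσmono : Antitone σ)
    (hSVD : Xᵀ * X = V * Matrix.diagonal (fun i => σ i ^ 2) * Vᵀ)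
    (θ : ℝ) (hθ : 1 < θ) (π : Equiv.Perm (Fin d))
    (hπ : ∀ i j : Fin d, i ≤ j → lev V k hkd.le (π j) ≤ lev V k hkd.le (π i))
    (q : ℕ) (hkq : k ≤ q) (hqd : q ≤ d)
    (hq : (k : ℝ) - 1 + 1 / θ ≤
      ∑ i ∈ Finset.univ.filter (fun i : Fin d => (i : ℕ) < q), lev V k hkd.le (π i)) :
    1 / θ ≤
      ∑ S ∈ Finset.univ.filter
          (fun S : {S : Finset (Fin d) // S.card = k} =>
            S.1 ⊆ (Finset.univ.filter (fun i : Fin d => (i : ℕ) < q)).image π),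
        detSq V hkd.le S := by
  let W : Matrix (Fin d) (Fin k) ℝ := V.submatrix id (Fin.castLE hkd.le)
  let Q := (Finset.univ.filter (fun i : Fin d => (i : ℕ) < q)).image π
  let P : Matrix (Fin d) (Fin d) ℝ := diagonal (fun i => if i ∈ Q then 1 else 0)
  have hPP : Pᵀ * P = P := by simp [P]
  have hPP' : (1 - P)ᵀ * (1 - P) = 1 - P := by
    have hPt : Pᵀ = P := diagonal_transpose _
    rw [hPt] at hPP
    rw [transpose_sub, transpose_one, hPt, sub_mul, mul_sub P, hPP]
    simp
  have hW : Wᵀ * W = 1 := by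
    have h := congrArg (fun M => M.submatrix (Fin.castLE hkd.le) (Fin.castLE hkd.le)) hV
    rwa [submatrix_one _ (Fin.castLE_injective hkd.le)] at h
  have hG : (Wᵀ * P * W).PosSemidef := by
    have h := posSemidef_conjTranspose_mul_self (P * W)
    rwa [conjTranspose_eq_transpose_of_trivial, transpose_mul, Matrix.mul_assoc,
      ← Matrix.mul_assoc Pᵀ, hPP, ← Matrix.mul_assoc] at h
  have hG1 : (1 - Wᵀ * P * W).PosSemidef := by
    have h := posSemidef_conjTranspose_mul_self ((1 - P) * W)
    rwa [conjTranspose_eq_transpose_of_trivial, transpose_mul, Matrix.mul_assoc,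
      ← Matrix.mul_assoc (1 - P)ᵀ, hPP', ← Matrix.mul_assoc, Matrix.mul_sub, Matrix.sub_mul,
      Matrix.mul_one, hW] at h
  have htr : (Wᵀ * P * W).trace =
      ∑ i ∈ Finset.univ.filter (fun i : Fin d => (i : ℕ) < q), lev V k hkd.le (π i) := by
    rw [← Finset.sum_image (s := Finset.univ.filter (fun i : Fin d => (i : ℕ) < q))
      (f := lev V k hkd.le) (g := π) π.injective.injOn, Matrix.mul_assoc, trace_mul_comm,
      Matrix.mul_assoc, trace]
    change _ = ∑ i ∈ Q, _
    rw [← Finset.univ_inter Q, ← Finset.sum_ite_mem]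
    refine Finset.sum_congr rfl fun i _ => ?_
    rw [diag_apply, diagonal_mul]
    split_ifs
    · simp [lev, W, Matrix.mul_apply, sq]
    · simp
  have hdet := hG.trace_sub_card_add_one_le_det hG1
  rw [htr, Fintype.card_fin, Matrix.det_transpose_mul_diagonal_mul W Q] at hdet
  calc 1 / θ ≤ _ := by linarith
    _ ≤ _ := hdet
end

section
/- Let V be a d×d real orthogonal matrix, 1 ≤ k < d, and p the number of rows i with (V_{i,1},…,V_{i,k}) ≠ 0. For each size-k subset S of {1,…,d} with det(V_{S,[k]}) ≠ 0, set Z_S = (V_{S,[k+1:d]})ᵀ · ((V_{S,[k]})ᵀ)⁻¹ ∈ ℝ^{(d−k)×k}. Then the DPP expectation of the sum of squared tangents of the principal angles between the selected coordinate subspace and the top-k right singular subspace satisfies ∑_{S⊆{1,…,d}, |S|=k, det(V_{S,[k]})≠0} det(V_{S,[k]})² · Tr(Z_S Z_Sᵀ) ≤ k(p−k). -/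
open Matrix

/-- `V_{S,[k]}`: the `k×k` submatrix of `V` with rows indexed by `S` and columns `1,…,k`. -/
noncomputable def Vlow {d : ℕ} (V : Matrix (Fin d) (Fin d) ℝ) {k : ℕ} (hkd : k ≤ d)
    (S : {S : Finset (Fin d) // S.card = k}) : Matrix (Fin k) (Fin k) ℝ :=
  V.submatrix (rowEnum S) (Fin.castLE hkd)

/-- `V_{S,[k+1:d]}`: the `k×(d-k)` submatrix of `V` with rows indexed by `S` and columns
`k+1,…,d`. -/
noncomputable def Vhigh {d : ℕ} (V : Matrix (Fin d) (Fin d) ℝ) {k : ℕ} (hkd : k ≤ d)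
    (S : {S : Finset (Fin d) // S.card = k}) : Matrix (Fin k) (Fin (d - k)) ℝ :=
  V.submatrix (rowEnum S) (fun j : Fin (d - k) => (⟨k + (j : ℕ), by have := j.isLt; omega⟩ : Fin d))

/-- `Z_S = (V_{S,[k+1:d]})ᵀ · ((V_{S,[k]})ᵀ)⁻¹ ∈ ℝ^{(d-k)×k}` whose squared Frobenius norm is the
sum of the squared tangents of the principal angles between `span{e_i : i ∈ S}` and the span of
the first `k` columns of `V`. -/
noncomputable def ZS {d : ℕ} (V : Matrix (Fin d) (Fin d) ℝ) {k : ℕ} (hkd : k ≤ d)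
    (S : {S : Finset (Fin d) // S.card = k}) : Matrix (Fin (d - k)) (Fin k) ℝ :=
  (Vhigh V hkd S)ᵀ * ((Vlow V hkd S)ᵀ)⁻¹

open Equiv in
/-- **Cauchy–Binet formula** for a Gram determinant, summed over all functions instead of
subsets. -/
theorem sum_det_submatrix_sq {ι n R : Type*} [Fintype ι] [Fintype n] [DecidableEq n] [CommRing R]
    (A : Matrix ι n R) :
    ∑ f : n → ι, (A.submatrix f id).det ^ 2 = (Fintype.card n).factorial * (Aᵀ * A).det := by
  classical
  have hdet : (Aᵀ * A).det = ∑ f : n → ι, (∏ i, A (f i) i) * (A.submatrix f id).det := by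
    simp only [← det_transpose (A.submatrix _ id), det_apply', mul_apply,
      Finset.prod_univ_sum, Finset.mul_sum, Fintype.piFinset_univ]
    rw [Finset.sum_comm]
    refine Finset.sum_congr rfl fun f _ => Finset.sum_congr rfl fun σ _ => ?_
    simp only [transpose_apply, submatrix_apply, id, Finset.prod_mul_distrib]
    ring
  have hperm (τ : Perm n) : (Aᵀ * A).det =
      ∑ f : n → ι, Perm.sign τ * (∏ i, A (f (τ i)) i) * (A.submatrix f id).det := by
    rw [hdet]
    refine Fintype.sum_equiv (Equiv.arrowCongr τ (Equiv.refl ι)) _ _ fun f => ?_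
    have h := det_permute τ (A.submatrix (f ∘ τ.symm) id)
    rw [submatrix_submatrix] at h
    have h' : (f ∘ τ.symm) ∘ τ = f := by ext; simp
    rw [h'] at h
    simp [arrowCongr, Function.comp_def] at h ⊢
    rw [h]
    ring
  calc ∑ f : n → ι, (A.submatrix f id).det ^ 2
      = ∑ f : n → ι, ∑ τ : Perm n,
          Perm.sign τ * (∏ i, A (f (τ i)) i) * (A.submatrix f id).det := by
        refine Finset.sum_congr rfl fun f _ => ?_
        rw [← Finset.sum_mul, sq]
        congr 1
        simp [det_apply']
    _ = ∑ _τ : Perm n, (Aᵀ * A).det := by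
        rw [Finset.sum_comm]
        exact Finset.sum_congr rfl fun τ _ => (hperm τ).symm
    _ = _ := by simp [Fintype.card_perm]

theorem rowEnum_injective {d k : ℕ} (S : {S : Finset (Fin d) // S.card = k}) :
    Function.Injective (rowEnum S) :=
  Subtype.val_injective.comp (S.1.orderIsoOfFin S.2).injective

theorem range_rowEnum {d k : ℕ} (S : {S : Finset (Fin d) // S.card = k}) :
    Set.range (rowEnum S) = S.1 := by
  change Set.range (Subtype.val ∘ _) = _
  rw [(S.1.orderIsoOfFin S.2).surjective.range_comp]
  simp

/-- A symmetric function of `k`-tuples vanishing on tuples with a repeated entry can be summed over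
`k`-element subsets. -/
theorem sum_tuple_eq_factorial_mul_sum_rowEnum {d k : ℕ} {R : Type*} [Semiring R]
    (F : (Fin k → Fin d) → R) (hperm : ∀ f (τ : Equiv.Perm (Fin k)), F (f ∘ τ) = F f)
    (hinj : ∀ f, ¬ Function.Injective f → F f = 0) :
    ∑ f, F f = k.factorial * ∑ S : {S : Finset (Fin d) // S.card = k}, F (rowEnum S) := by
  have h : ∑ x : {S : Finset (Fin d) // S.card = k} × Equiv.Perm (Fin k), F (rowEnum x.1)
      = ∑ f, F f := by
    refine Fintype.sum_of_injective (fun x => rowEnum x.1 ∘ x.2) ?_ _ _ ?_ ?_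
    · rintro ⟨S, σ⟩ ⟨T, τ⟩ hST
      dsimp only at hST
      have hr := congrArg Set.range hST
      rw [σ.surjective.range_comp, τ.surjective.range_comp, range_rowEnum, range_rowEnum] at hr
      obtain rfl : S = T := Subtype.ext (Finset.coe_injective hr)
      obtain rfl : σ = τ :=
        Equiv.ext fun i => rowEnum_injective S (congrFun hST i)
      rfl
    · intro f hf
      refine hinj f fun hfi => hf ?_
      let S : {S : Finset (Fin d) // S.card = k} :=
        ⟨Finset.univ.image f, by simp [Finset.card_image_of_injective _ hfi]⟩
      have hmem (i) : ∃ j, rowEnum S j = f i := by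
        rw [← Set.mem_range, range_rowEnum]
        simp [S]
      choose τ hτ using hmem
      have hτi : Function.Injective τ := fun i j hij => hfi (by rw [← hτ, ← hτ, hij])
      exact ⟨(S, Equiv.ofBijective τ (Finite.injective_iff_bijective.1 hτi)), funext hτ⟩
    · exact fun x => (hperm _ _).symm
  rw [← h, Fintype.sum_prod_type]
  simp [Fintype.card_perm, Finset.mul_sum]

theorem det_submatrix_eq_zero_of_not_injective {ι n R : Type*} [Fintype n] [DecidableEq n]
    [CommRing R] (A : Matrix ι n R) {f : n → ι} (hf : ¬ Function.Injective f) :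
    (A.submatrix f id).det = 0 := by
  simp only [Function.Injective, not_forall] at hf
  obtain ⟨i, j, hij, hne⟩ := hf
  exact det_zero_of_row_eq hne (by ext; simp [hij])

/-- The squared Frobenius norm of the adjugate does not depend on the order of the rows. -/
theorem sum_adjugate_sq_submatrix_perm {n R : Type*} [Fintype n] [DecidableEq n] [CommRing R]
    (M : Matrix n n R) (τ : Equiv.Perm n) :
    ∑ i, ∑ j, (M.submatrix τ id).adjugate i j ^ 2 = ∑ i, ∑ j, M.adjugate i j ^ 2 := by
  have h (i j) : (M.submatrix τ id).adjugate i j ^ 2 = M.adjugate i (τ j) ^ 2 := by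
    have hu : (M.submatrix τ id).updateRow j (Pi.single i 1) =
        (M.updateRow (τ j) (Pi.single i 1)).submatrix τ id := by
      ext a b
      simp [updateRow_apply]
    rw [adjugate_apply, adjugate_apply, hu, det_permute, mul_pow, ← Int.cast_pow,
      ← Units.val_pow_eq_pow_val]
    simp
  simp only [h]
  exact Finset.sum_congr rfl fun i _ => Equiv.sum_comp τ fun j => M.adjugate i j ^ 2

theorem adjugate_sq_insertNth {ι R : Type*} {m : ℕ} [CommRing R] (A : Matrix ι (Fin (m + 1)) R)
    (i j : Fin (m + 1)) (x : ι) (g : Fin m → ι) :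
    (A.submatrix (j.insertNth x g : Fin (m + 1) → ι) id).adjugate i j ^ 2 =
      ((A.submatrix id i.succAbove).submatrix g id).det ^ 2 := by
  have h : (A.submatrix (j.insertNth x g : Fin (m + 1) → ι) id).submatrix
      j.succAbove i.succAbove = (A.submatrix id i.succAbove).submatrix g id := by
    ext a b
    simp
  rw [adjugate_fin_succ_eq_det_submatrix, mul_pow, ← pow_mul, mul_comm _ 2, pow_mul, h]
  simp

open scoped Classical in
/-- At most `p - m` rows extend an independent family of `m` rows to one of size `m + 1`, where `p`
is the number of nonzero rows. -/
theorem card_filter_det_insertNth_ne_zero_le {ι R : Type*} {m : ℕ} [Fintype ι] [CommRing R]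
    (A : Matrix ι (Fin (m + 1)) R) (i j : Fin (m + 1)) {g : Fin m → ι}
    (hg : ((A.submatrix id i.succAbove).submatrix g id).det ≠ 0) :
    ((Finset.univ.filter fun x =>
      (A.submatrix (j.insertNth x g : Fin (m + 1) → ι) id).det ≠ 0).card : ℝ) ≤
      (Finset.univ.filter fun x => ∃ c, A x c ≠ 0).card - m := by
  have hginj : Function.Injective g :=
    not_imp_comm.1 (det_submatrix_eq_zero_of_not_injective _) hg
  have hsub : Finset.univ.image g ⊆ Finset.univ.filter fun x => ∃ c, A x c ≠ 0 := by
    intro x hx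
    obtain ⟨a, -, rfl⟩ := Finset.mem_image.1 hx
    simp only [Finset.mem_filter, Finset.mem_univ, true_and]
    by_contra! h
    exact hg (det_eq_zero_of_row_eq_zero a fun b => h _)
  have hdisj : (Finset.univ.filter fun x =>
      (A.submatrix (j.insertNth x g : Fin (m + 1) → ι) id).det ≠ 0) ⊆
      (Finset.univ.filter fun x => ∃ c, A x c ≠ 0) \ Finset.univ.image g := by
    intro x hx
    simp only [Finset.mem_filter, Finset.mem_univ, true_and, Finset.mem_sdiff, Finset.mem_image,
      not_exists] at hx ⊢
    refine ⟨?_, fun a ha => ?_⟩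
    · by_contra! h
      exact hx (det_eq_zero_of_row_eq_zero j fun b => by simp [h])
    · have hinj := not_imp_comm.1 (det_submatrix_eq_zero_of_not_injective A) hx
      exact Fin.succAbove_ne j a (hinj (by simp [ha]))
  have hc := Finset.card_le_card hdisj
  have hp := Finset.card_le_card hsub
  rw [Finset.card_sdiff_of_subset hsub] at hc
  rw [Finset.card_image_of_injective _ hginj, Finset.card_univ, Fintype.card_fin] at hc hp
  rw [← Nat.cast_sub hp]
  exact_mod_cast hc

open scoped Classical in
theorem sum_adjugate_sq_le {ι : Type*} {m : ℕ} [Fintype ι] (A : Matrix ι (Fin (m + 1)) ℝ)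
    (hA : Aᵀ * A = 1) :
    ∑ f : Fin (m + 1) → ι, (if (A.submatrix f id).det ≠ 0 then
        ∑ i, ∑ j, (A.submatrix f id).adjugate i j ^ 2 else 0) ≤
      (m + 1) * (m + 1).factorial * ((Finset.univ.filter fun x => ∃ c, A x c ≠ 0).card - m) := by
  set p : ℝ := ((Finset.univ.filter fun x => ∃ c, A x c ≠ 0).card : ℝ)
  have hentry (i j : Fin (m + 1)) : ∑ f : Fin (m + 1) → ι, (if (A.submatrix f id).det ≠ 0 then
      (A.submatrix f id).adjugate i j ^ 2 else 0) ≤ m.factorial * (p - m) := by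
    have hminor : (A.submatrix id i.succAbove)ᵀ * A.submatrix id i.succAbove = 1 := by
      have h := congrArg (fun M => M.submatrix i.succAbove i.succAbove) hA
      rwa [← submatrix_mul_equiv _ _ _ (Equiv.refl ι), submatrix_one _ Fin.succAbove_right_injective]
        at h
    rw [← (Fin.insertNthEquiv (fun _ => ι) j).sum_comp, Fintype.sum_prod_type_right]
    calc _ ≤ ∑ g : Fin m → ι, ((A.submatrix id i.succAbove).submatrix g id).det ^ 2 * (p - m) := by
          refine Finset.sum_le_sum fun g _ => ?_
          simp only [Fin.insertNthEquiv, Equiv.coe_fn_mk, adjugate_sq_insertNth]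
          rw [← Finset.sum_filter, Finset.sum_const, nsmul_eq_mul, mul_comm]
          by_cases hg : ((A.submatrix id i.succAbove).submatrix g id).det = 0
          · rw [hg]
            simp
          · exact mul_le_mul_of_nonneg_left (card_filter_det_insertNth_ne_zero_le A i j hg)
              (sq_nonneg _)
      _ = _ := by
          rw [← Finset.sum_mul, sum_det_submatrix_sq, hminor]
          simp
  calc _ = ∑ i : Fin (m + 1), ∑ j : Fin (m + 1), ∑ f : Fin (m + 1) → ι,
        (if (A.submatrix f id).det ≠ 0 then (A.submatrix f id).adjugate i j ^ 2 else 0) := by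
        simp only [← Finset.sum_comm (s := (Finset.univ : Finset (Fin (m + 1) → ι)))]
        refine Finset.sum_congr rfl fun f _ => ?_
        split_ifs <;> simp
    _ ≤ ∑ i : Fin (m + 1), ∑ j : Fin (m + 1), m.factorial * (p - m) :=
        Finset.sum_le_sum fun i _ => Finset.sum_le_sum fun j _ => hentry i j
    _ = _ := by
        simp [Nat.factorial_succ]
        ring

theorem Vlow_mul_transpose_add {d k : ℕ} (hkd : k ≤ d) (V : Matrix (Fin d) (Fin d) ℝ)
    (hV : Vᵀ * V = 1) (S : {S : Finset (Fin d) // S.card = k}) :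
    Vlow V hkd S * (Vlow V hkd S)ᵀ + Vhigh V hkd S * (Vhigh V hkd S)ᵀ = 1 := by
  have hV' : V * Vᵀ = 1 := mul_eq_one_comm.1 hV
  obtain ⟨e, rfl⟩ := Nat.exists_eq_add_of_le hkd
  ext a b
  have h := congrFun₂ hV' (rowEnum S a) (rowEnum S b)
  rw [mul_apply, Fin.sum_univ_add] at h
  have hone : (1 : Matrix (Fin (k + e)) (Fin (k + e)) ℝ) (rowEnum S a) (rowEnum S b) =
      (1 : Matrix (Fin k) (Fin k) ℝ) a b := by
    simp [one_apply, (rowEnum_injective S).eq_iff]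
  rw [← hone, ← h, Matrix.add_apply, mul_apply, mul_apply]
  refine congrArg₂ _ rfl ?_
  exact Fintype.sum_equiv (finCongr (by omega)) _ _ fun j => rfl

theorem det_sq_mul_trace_ZS {d k : ℕ} (hkd : k ≤ d) (V : Matrix (Fin d) (Fin d) ℝ)
    (hV : Vᵀ * V = 1) (S : {S : Finset (Fin d) // S.card = k}) (hS : (Vlow V hkd S).det ≠ 0) :
    (Vlow V hkd S).det ^ 2 * trace (ZS V hkd S * (ZS V hkd S)ᵀ) =
      ∑ i, ∑ j, (Vlow V hkd S).adjugate i j ^ 2 - k * (Vlow V hkd S).det ^ 2 := by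
  have h := Vlow_mul_transpose_add hkd V hV S
  rw [ZS]
  set B := Vhigh V hkd S
  set M := Vlow V hkd S
  have hu : IsUnit M.det := isUnit_iff_ne_zero.2 hS
  have hB : B * Bᵀ = 1 - M * Mᵀ := eq_sub_of_add_eq' h
  have htr : trace (Bᵀ * Mᵀ⁻¹ * (Bᵀ * Mᵀ⁻¹)ᵀ) = trace (M⁻¹ * M⁻¹ᵀ) - k := by
    rw [trace_mul_comm, transpose_mul, transpose_transpose, transpose_nonsing_inv,
      transpose_transpose, Matrix.mul_assoc, ← Matrix.mul_assoc B, hB, ← transpose_nonsing_inv,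
      Matrix.sub_mul, Matrix.mul_sub, Matrix.one_mul, Matrix.mul_assoc M, ← transpose_mul,
      nonsing_inv_mul _ hu, transpose_one, Matrix.mul_one, nonsing_inv_mul _ hu, trace_sub,
      trace_one, Fintype.card_fin]
  have hadj (i j) : M.det ^ 2 * (M⁻¹ i j * M⁻¹ i j) = M.adjugate i j ^ 2 := by
    rw [inv_def, Matrix.smul_apply, Ring.inverse_eq_inv', smul_eq_mul]
    field_simp
  rw [htr, mul_sub, mul_comm (k : ℝ)]
  simp only [trace, diag_apply, mul_apply, transpose_apply, Finset.mul_sum, hadj]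

open scoped Classical in
theorem dpp_expected_sum_tan_sq_bound {d k : ℕ} (hk : 1 ≤ k) (hkd : k < d)
    (V : Matrix (Fin d) (Fin d) ℝ) (hV : Vᵀ * V = 1) :
    ∑ S ∈ Finset.univ.filter
        (fun S : {S : Finset (Fin d) // S.card = k} => (Vlow V hkd.le S).det ≠ 0),
      (Vlow V hkd.le S).det ^ 2 * Matrix.trace (ZS V hkd.le S * (ZS V hkd.le S)ᵀ) ≤
      (k : ℝ) *
        (((Finset.univ.filter fun i : Fin d => ∃ j : Fin k, V i (Fin.castLE hkd.le j) ≠ 0).card :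
          ℝ) - (k : ℝ)) := by
  obtain ⟨m, rfl⟩ : ∃ m, k = m + 1 := Nat.exists_eq_add_of_le' hk
  set A : Matrix (Fin d) (Fin (m + 1)) ℝ := V.submatrix id (Fin.castLE hkd.le) with hAdef
  have hA : Aᵀ * A = 1 := by
    have h := congrArg (fun M => M.submatrix (Fin.castLE hkd.le) (Fin.castLE hkd.le)) hV
    rwa [← submatrix_mul_equiv _ _ _ (Equiv.refl (Fin d)),
      submatrix_one _ (Fin.castLE_injective hkd.le)] at h
  have hlow (S) : A.submatrix (rowEnum S) id = Vlow V hkd.le S := rfl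
  have hdet_perm (f : Fin (m + 1) → Fin d) (τ : Equiv.Perm (Fin (m + 1))) :
      (A.submatrix (f ∘ τ) id).det ^ 2 = (A.submatrix f id).det ^ 2 := by
    have h := det_permute τ (A.submatrix f id)
    rw [submatrix_submatrix, Function.id_comp] at h
    rw [h, mul_pow, ← Int.cast_pow, ← Units.val_pow_eq_pow_val]
    simp
  have hdet := sum_det_submatrix_sq A
  rw [sum_tuple_eq_factorial_mul_sum_rowEnum (fun f => (A.submatrix f id).det ^ 2) hdet_perm
    (fun f hf => by simp [det_submatrix_eq_zero_of_not_injective A hf]), hA] at hdet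
  have hadj := sum_adjugate_sq_le A hA
  rw [sum_tuple_eq_factorial_mul_sum_rowEnum (R := ℝ) _ (fun f τ => ?_)
    (fun f hf => by simp [det_submatrix_eq_zero_of_not_injective A hf])] at hadj
  · simp only [hlow, det_one, mul_one, Fintype.card_fin] at hdet hadj
    have hfac : (0 : ℝ) < (m + 1).factorial := by positivity
    rw [mul_eq_left₀ hfac.ne'] at hdet
    rw [mul_comm ((m : ℝ) + 1), mul_assoc] at hadj
    have hadj := le_of_mul_le_mul_left hadj hfac
    rw [Finset.sum_congr rfl fun S hS =>
      det_sq_mul_trace_ZS hkd.le V hV S (Finset.mem_filter.1 hS).2, Finset.sum_sub_distrib,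
      Finset.sum_filter, ← Finset.mul_sum,
      Finset.sum_filter_of_ne (p := fun S => (Vlow V hkd.le S).det ≠ 0) fun S _ h => ne_zero_pow two_ne_zero h, hdet]
    simp only [hAdef, submatrix_apply, id] at hadj
    push_cast
    linarith
  · have hz : (A.submatrix (f ∘ τ) id).det ≠ 0 ↔ (A.submatrix f id).det ≠ 0 := by
      rw [← pow_ne_zero_iff two_ne_zero, hdet_perm, pow_ne_zero_iff two_ne_zero]
    have h := sum_adjugate_sq_submatrix_perm (A.submatrix f id) τ
    rw [submatrix_submatrix, Function.id_comp] at h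
    simp only [hz, h]
end

section
/- Let V be a real k×d matrix and let p be the number of nonzero columns of V. Then ∑_{S⊆{1,…,d}, |S|=k, det((V_{:,S})ᵀV_{:,S})>0} ∑_{T⊆S, |T|=k−1} det((V_{:,T})ᵀV_{:,T}) ≤ (p−k+1) · e_{k−1}(λ_1,…,λ_k), where λ_1,…,λ_k are the eigenvalues of the symmetric matrix V·Vᵀ (i.e., the squared singular values of V); here det((V_{:,T})ᵀV_{:,T}) equals e_{k−1} of the squared singular values of V_{:,T} since |T| = k−1. A fortiori the same sum is at most (d−k+1)·e_{k−1}(λ_1,…,λ_k). -/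
open Matrix

/-- The increasing enumeration of a size-`m` subset of `Fin d`. -/
def subsetEnum {d m : ℕ} (S : {S : Finset (Fin d) // S.card = m}) : Fin m → Fin d :=
  fun i => ((S.1.orderIsoOfFin S.2) i).1

/-- The submatrix of `V` keeping the columns indexed by the size-`m` subset `S`. -/
def colsub {k d m : ℕ} (V : Matrix (Fin k) (Fin d) ℝ)
    (S : {S : Finset (Fin d) // S.card = m}) : Matrix (Fin k) (Fin m) ℝ :=
  V.submatrix id (subsetEnum S)

/-- The `ℓ`-th elementary symmetric polynomial in `n` variables. -/
noncomputable def esymm {n : ℕ} (ℓ : ℕ) (f : Fin n → ℝ) : ℝ :=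
  ∑ T ∈ (Finset.univ : Finset (Fin n)).powersetCard ℓ, ∏ j ∈ T, f j

/-- The sum of the principal minors of size `m` is invariant under `A * B ↦ B * A`. -/
theorem sum_principal_minors_mul_comm {n n' : Type*} [Fintype n] [DecidableEq n]
    [Fintype n'] [DecidableEq n'] (m : ℕ) (A : Matrix n n' ℝ) (B : Matrix n' n ℝ) :
    ∑ s ∈ Finset.univ.powersetCard m,
        ((A * B).submatrix (Subtype.val : s → n) Subtype.val).det =
      ∑ s ∈ Finset.univ.powersetCard m,
        ((B * A).submatrix (Subtype.val : s → n') Subtype.val).det := by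
  rw [← coeff_det_one_add_X_smul_eq_sum_minors, ← coeff_det_one_add_X_smul_eq_sum_minors,
    Matrix.map_mul, Matrix.map_mul, ← Matrix.smul_mul, det_one_add_mul_comm, Matrix.mul_smul]

theorem esymm_eq_sum_principal_minors {n : ℕ} (m : ℕ) (f : Fin n → ℝ) :
    esymm m f = ∑ s ∈ Finset.univ.powersetCard m,
      ((diagonal f).submatrix (Subtype.val : s → Fin n) Subtype.val).det := by
  refine Finset.sum_congr rfl fun s _ => ?_
  rw [submatrix_diagonal _ _ Subtype.val_injective, det_diagonal]
  exact (Finset.prod_coe_sort s f).symm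

theorem gram_colsub {k d m : ℕ} (V : Matrix (Fin k) (Fin d) ℝ)
    (S : {S : Finset (Fin d) // S.card = m}) :
    (colsub V S)ᵀ * colsub V S = (Vᵀ * V).submatrix (subsetEnum S) (subsetEnum S) := rfl

theorem det_gram_colsub {k d m : ℕ} (V : Matrix (Fin k) (Fin d) ℝ)
    (S : {S : Finset (Fin d) // S.card = m}) :
    ((colsub V S)ᵀ * colsub V S).det =
      ((Vᵀ * V).submatrix (Subtype.val : S.1 → Fin d) Subtype.val).det := by
  rw [gram_colsub]
  exact det_submatrix_equiv_self (S.1.orderIsoOfFin S.2).toEquiv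
    ((Vᵀ * V).submatrix (Subtype.val : S.1 → Fin d) Subtype.val)

theorem det_gram_colsub_nonneg {k d m : ℕ} (V : Matrix (Fin k) (Fin d) ℝ)
    (S : {S : Finset (Fin d) // S.card = m}) :
    0 ≤ ((colsub V S)ᵀ * colsub V S).det := by
  simpa [conjTranspose_eq_transpose_of_trivial] using
    (posSemidef_conjTranspose_mul_self (colsub V S)).det_nonneg

/-- A subset of columns with nonzero Gram determinant consists of nonzero columns. -/
theorem exists_ne_zero_of_det_gram_colsub_ne_zero {k d m : ℕ} {V : Matrix (Fin k) (Fin d) ℝ}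
    {S : {S : Finset (Fin d) // S.card = m}} (h : ((colsub V S)ᵀ * colsub V S).det ≠ 0)
    {j : Fin d} (hj : j ∈ S.1) : ∃ i, V i j ≠ 0 := by
  by_contra! hV
  rw [det_gram_colsub] at h
  refine h (det_eq_zero_of_column_eq_zero ⟨j, hj⟩ fun i => ?_)
  simp [Matrix.mul_apply, hV]

/-- Summing the Gram determinants of all `m`-subsets of columns gives the `m`-th elementary
symmetric polynomial of the eigenvalues of `V * Vᵀ`. -/
theorem sum_det_gram_colsub {k d : ℕ} (m : ℕ) (V : Matrix (Fin k) (Fin d) ℝ)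
    (U : Matrix (Fin k) (Fin k) ℝ) (hU : Uᵀ * U = 1) (lam : Fin k → ℝ)
    (hlam : V * Vᵀ = U * diagonal lam * Uᵀ) :
    ∑ T : {T : Finset (Fin d) // T.card = m}, ((colsub V T)ᵀ * colsub V T).det =
      esymm m lam := by
  rw [esymm_eq_sum_principal_minors]
  calc
    _ = ∑ s ∈ Finset.univ.powersetCard m,
          ((Vᵀ * V).submatrix (Subtype.val : s → Fin d) Subtype.val).det := by
      simp only [det_gram_colsub]
      exact (Finset.sum_subtype (Finset.univ.powersetCard m) (by simp)
        fun s : Finset (Fin d) =>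
          ((Vᵀ * V).submatrix (Subtype.val : s → Fin d) Subtype.val).det).symm
    _ = _ := by
      rw [sum_principal_minors_mul_comm, hlam, Matrix.mul_assoc, sum_principal_minors_mul_comm,
        Matrix.mul_assoc, hU, Matrix.mul_one]

open scoped Classical in
/-- A set of columns with nonzero Gram determinant has at most `p - m` one-element extensions with
positive Gram determinant, where `p` is the number of nonzero columns. -/
theorem card_extensions_add_le {k d m n : ℕ} (hn : m + 1 = n) (V : Matrix (Fin k) (Fin d) ℝ)
    (T : {T : Finset (Fin d) // T.card = m}) (hT : ((colsub V T)ᵀ * colsub V T).det ≠ 0) :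
    (Finset.univ.filter fun S : {S : Finset (Fin d) // S.card = n} =>
        0 < ((colsub V S)ᵀ * colsub V S).det ∧ T.1 ⊆ S.1).card + m ≤
      (Finset.univ.filter fun j : Fin d => ∃ i : Fin k, V i j ≠ 0).card := by
  set N := Finset.univ.filter fun j : Fin d => ∃ i : Fin k, V i j ≠ 0
  have hTN : T.1 ⊆ N := fun j hj => by
    simpa [N] using exists_ne_zero_of_det_gram_colsub_ne_zero hT hj
  have hsub : (Finset.univ.filter fun S : {S : Finset (Fin d) // S.card = n} =>
      0 < ((colsub V S)ᵀ * colsub V S).det ∧ T.1 ⊆ S.1).image Subtype.val ⊆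
      (N \ T.1).image fun j => insert j T.1 := by
    intro S' hS'
    obtain ⟨S, hS, rfl⟩ := Finset.mem_image.mp hS'
    obtain ⟨hdet, hTS⟩ := (Finset.mem_filter.mp hS).2
    obtain ⟨j, hjT, hj⟩ := Finset.exists_eq_insert_iff.mpr ⟨hTS, by rw [T.2, S.2, hn]⟩
    refine Finset.mem_image.mpr ⟨j, Finset.mem_sdiff.mpr ⟨?_, hjT⟩, hj⟩
    simpa [N] using exists_ne_zero_of_det_gram_colsub_ne_zero hdet.ne'
      (hj ▸ Finset.mem_insert_self j T.1)
  have hcard := (Finset.card_le_card hsub).trans Finset.card_image_le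
  rw [Finset.card_image_of_injective _ Subtype.val_injective] at hcard
  have := Finset.card_sdiff_add_card_eq_card hTN
  rw [T.2] at this
  omega

open scoped Classical in
theorem sum_of_esymm_minors_bound {k d : ℕ} (hk : 1 ≤ k)
    (V : Matrix (Fin k) (Fin d) ℝ)
    (U : Matrix (Fin k) (Fin k) ℝ) (hU : Uᵀ * U = 1) (lam : Fin k → ℝ)
    (hlam : V * Vᵀ = U * Matrix.diagonal lam * Uᵀ) :
    (∑ S ∈ Finset.univ.filter
        (fun S : {S : Finset (Fin d) // S.card = k} => 0 < ((colsub V S)ᵀ * colsub V S).det),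
      ∑ T ∈ Finset.univ.filter
          (fun T : {T : Finset (Fin d) // T.card = k - 1} => T.1 ⊆ S.1),
        ((colsub V T)ᵀ * colsub V T).det ≤
      (((Finset.univ.filter fun j : Fin d => ∃ i : Fin k, V i j ≠ 0).card : ℝ) - (k : ℝ) + 1) *
        esymm (k - 1) lam) ∧
    (∑ S ∈ Finset.univ.filter
        (fun S : {S : Finset (Fin d) // S.card = k} => 0 < ((colsub V S)ᵀ * colsub V S).det),
      ∑ T ∈ Finset.univ.filter
          (fun T : {T : Finset (Fin d) // T.card = k - 1} => T.1 ⊆ S.1),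
        ((colsub V T)ᵀ * colsub V T).det ≤
      ((d : ℝ) - (k : ℝ) + 1) * esymm (k - 1) lam) := by
  have hsum := sum_det_gram_colsub (k - 1) V U hU lam hlam
  have hnonneg : 0 ≤ esymm (k - 1) lam :=
    hsum ▸ Finset.sum_nonneg fun T _ => det_gram_colsub_nonneg V T
  rw [and_iff_left_of_imp fun h => h.trans <| by
    gcongr
    simpa using Finset.card_le_univ (Finset.univ.filter fun j : Fin d => ∃ i : Fin k, V i j ≠ 0)]
  rw [← hsum, Finset.mul_sum, Finset.sum_comm' (t' := Finset.univ)
    (s' := fun T => Finset.univ.filter fun S : {S : Finset (Fin d) // S.card = k} =>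
      0 < ((colsub V S)ᵀ * colsub V S).det ∧ T.1 ⊆ S.1) (by simp)]
  refine Finset.sum_le_sum fun T _ => ?_
  rw [Finset.sum_const, nsmul_eq_mul]
  by_cases hT : ((colsub V T)ᵀ * colsub V T).det = 0
  · simp [hT]
  refine mul_le_mul_of_nonneg_right ?_ (det_gram_colsub_nonneg V T)
  have h := card_extensions_add_le (Nat.sub_add_cancel hk) V T hT
  rw [← Nat.cast_le (α := ℝ), Nat.cast_add, Nat.cast_sub hk, Nat.cast_one] at h
  linarith
end

section
/- Let k ≥ 1, θ > 1, and λ_1 ≥ λ_2 ≥ … ≥ λ_k be reals with 0 ≤ λ_i ≤ 1 for all i and ∑_{i=1}^k λ_i ≥ k − 1 + 1/θ. Then e_k(λ) = ∏_{i=1}^k λ_i ≥ 1/θ, and e_{k−1}(λ) ≤ (k − 1 + θ) · e_k(λ) (equivalently, e_{k−1}(λ)/e_k(λ) ≤ k − 1 + θ). -/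
/-- The Weierstrass product inequality. -/
theorem one_sub_sum_one_sub_le_prod {ι : Type*} (s : Finset ι) (f : ι → ℝ)
    (h0 : ∀ i, 0 ≤ f i) (h1 : ∀ i, f i ≤ 1) :
    1 - ∑ i ∈ s, (1 - f i) ≤ ∏ i ∈ s, f i := by
  classical
  induction s using Finset.induction_on with
  | empty => simp
  | insert a s ha ih =>
    rw [Finset.sum_insert ha, Finset.prod_insert ha]
    have hp : ∏ i ∈ s, f i ≤ 1 := Finset.prod_le_one (fun i _ => h0 i) (fun i _ => h1 i)
    nlinarith [mul_nonneg (sub_nonneg.2 (h1 a)) (sub_nonneg.2 hp)]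

theorem sum_inv_le_card_sub_one_add_inv_prod {ι : Type*} (s : Finset ι) (f : ι → ℝ)
    (h0 : ∀ i, 0 < f i) (h1 : ∀ i, f i ≤ 1) :
    ∑ i ∈ s, (f i)⁻¹ ≤ (s.card : ℝ) - 1 + (∏ i ∈ s, f i)⁻¹ := by
  classical
  induction s using Finset.induction_on with
  | empty => simp
  | insert a s ha ih =>
    rw [Finset.sum_insert ha, Finset.prod_insert ha, Finset.card_insert_of_notMem ha, mul_inv]
    have hp : ∏ i ∈ s, f i ≤ 1 := Finset.prod_le_one (fun i _ => (h0 i).le) (fun i _ => h1 i)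
    have hp' : 1 ≤ (∏ i ∈ s, f i)⁻¹ := (one_le_inv₀ (Finset.prod_pos fun i _ => h0 i)).2 hp
    have ha' : 1 ≤ (f a)⁻¹ := (one_le_inv₀ (h0 a)).2 (h1 a)
    push_cast
    nlinarith [mul_nonneg (sub_nonneg.2 ha') (sub_nonneg.2 hp')]

theorem esymm_card_sub_one {k : ℕ} (hk : 1 ≤ k) (f : Fin k → ℝ) :
    esymm (k - 1) f = ∑ i, ∏ j ∈ Finset.univ.erase i, f j := by
  unfold esymm
  symm
  refine Finset.sum_bij (fun i _ => Finset.univ.erase i) ?_ ?_ ?_ (fun _ _ => rfl)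
  · intro i _
    simp [Finset.mem_powersetCard]
  · intro i _ j _ hij
    by_contra hne
    have : i ∈ Finset.univ.erase j := by simp [hne]
    rw [← hij] at this
    simp at this
  · intro T hT
    have hc : Tᶜ.card = 1 := by
      rw [Finset.card_compl, (Finset.mem_powersetCard.1 hT).2, Fintype.card_fin]
      omega
    obtain ⟨i, hi⟩ := Finset.card_eq_one.1 hc
    refine ⟨i, Finset.mem_univ _, ?_⟩
    rw [← compl_compl T, hi, Finset.compl_singleton]

theorem esymm_bounds_of_sum_large {k : ℕ} (hk : 1 ≤ k) (θ : ℝ) (hθ : 1 < θ)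
    (lam : Fin k → ℝ) (hmono : Antitone lam)
    (h0 : ∀ i, 0 ≤ lam i) (h1 : ∀ i, lam i ≤ 1)
    (hsum : (k : ℝ) - 1 + 1 / θ ≤ ∑ i, lam i) :
    1 / θ ≤ ∏ i, lam i ∧
      esymm (k - 1) lam ≤ ((k : ℝ) - 1 + θ) * ∏ i, lam i := by
  have hP : 1 / θ ≤ ∏ i, lam i := by
    have h := one_sub_sum_one_sub_le_prod Finset.univ lam h0 h1
    rw [Finset.sum_sub_distrib] at h
    simp only [Finset.sum_const, Finset.card_univ, Fintype.card_fin, nsmul_eq_mul,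
      mul_one] at h
    linarith
  refine ⟨hP, ?_⟩
  have hθ0 : 0 < θ := one_pos.trans hθ
  have hpos : 0 < ∏ i, lam i := (one_div_pos.2 hθ0).trans_le hP
  have hlam : ∀ i, 0 < lam i := fun i =>
    (h0 i).lt_of_ne fun h => hpos.ne' (Finset.prod_eq_zero (Finset.mem_univ i) h.symm)
  have hsymm : esymm (k - 1) lam = (∑ i, (lam i)⁻¹) * ∏ i, lam i := by
    rw [esymm_card_sub_one hk, Finset.sum_mul]
    refine Finset.sum_congr rfl fun i _ => ?_
    rw [← Finset.mul_prod_erase _ lam (Finset.mem_univ i), inv_mul_cancel_left₀ (hlam i).ne']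
  have hinv : (∏ i, lam i)⁻¹ ≤ θ := by
    rw [one_div] at hP
    exact inv_le_of_inv_le₀ hθ0 hP
  have hsum_inv := sum_inv_le_card_sub_one_add_inv_prod Finset.univ lam hlam h1
  rw [Finset.card_univ, Fintype.card_fin] at hsum_inv
  rw [hsymm]
  exact mul_le_mul_of_nonneg_right (by linarith) hpos.le
end

section
/- The ratio e_{k−1}/e_k of consecutive elementary symmetric polynomials is Schur-convex on strictly positive vectors: if x_1 ≥ … ≥ x_d > 0 and y_1 ≥ … ≥ y_d > 0 satisfy ∑_{i=1}^m y_i ≤ ∑_{i=1}^m x_i for every m ∈ {1,…,d−1} and ∑_{i=1}^d y_i = ∑_{i=1}^d x_i (i.e., x majorizes y), then for every 1 ≤ k ≤ d one has e_{k−1}(y)/e_k(y) ≤ e_{k−1}(x)/e_k(x). -/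
open Finset

/-- The `ℓ`-th elementary symmetric polynomial in the variables indexed by `s`. -/
noncomputable def esymmOn {ι : Type*} (s : Finset ι) (ℓ : ℕ) (f : ι → ℝ) : ℝ :=
  ∑ T ∈ s.powersetCard ℓ, ∏ j ∈ T, f j

section esymmOn

variable {ι : Type*} {s : Finset ι} {f g : ι → ℝ}

lemma esymmOn_zero : esymmOn s 0 f = 1 := by simp [esymmOn]

lemma esymmOn_nonneg (hf : ∀ i, 0 ≤ f i) (ℓ : ℕ) : 0 ≤ esymmOn s ℓ f :=
  sum_nonneg fun _ _ => prod_nonneg fun i _ => hf i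

lemma esymmOn_pos (hf : ∀ i, 0 < f i) {ℓ : ℕ} (hℓ : ℓ ≤ #s) : 0 < esymmOn s ℓ f :=
  sum_pos (fun _ _ => prod_pos fun i _ => hf i) (powersetCard_nonempty.2 hℓ)

lemma esymmOn_congr (h : ∀ i ∈ s, f i = g i) (ℓ : ℕ) : esymmOn s ℓ f = esymmOn s ℓ g :=
  sum_congr rfl fun _ hT => prod_congr rfl fun i hi => h i ((mem_powersetCard.1 hT).1 hi)

lemma esymmOn_insert_succ [DecidableEq ι] {a : ι} (ha : a ∉ s) (ℓ : ℕ) :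
    esymmOn (insert a s) (ℓ + 1) f = esymmOn s (ℓ + 1) f + f a * esymmOn s ℓ f := by
  have hmem : ∀ T ∈ s.powersetCard ℓ, a ∉ T := fun T hT h => ha ((mem_powersetCard.1 hT).1 h)
  unfold esymmOn
  rw [powersetCard_succ_insert ha, sum_union, sum_image, mul_sum]
  · congr 1
    exact sum_congr rfl fun T hT => prod_insert (hmem T hT)
  · intro T hT U hU h
    rw [← erase_insert (hmem T hT), ← erase_insert (hmem U hU), h]
  · rw [disjoint_left]
    intro T hT h
    obtain ⟨U, -, rfl⟩ := mem_image.1 h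
    exact ha ((mem_powersetCard.1 hT).1 (mem_insert_self a U))

/-- The sequence of elementary symmetric polynomials of nonnegative numbers is log-concave. -/
lemma esymmOn_mul_le (hf : ∀ i, 0 ≤ f i) {i j : ℕ} (hij : i ≤ j) :
    esymmOn s i f * esymmOn s (j + 1) f ≤ esymmOn s (i + 1) f * esymmOn s j f := by
  classical
  induction s using Finset.induction_on generalizing i j with
  | empty =>
    have h : esymmOn (∅ : Finset ι) (j + 1) f = 0 := by
      rw [esymmOn, powersetCard_eq_empty.2 (by simp), sum_empty]
    rw [h, mul_zero]
    exact mul_nonneg (esymmOn_nonneg hf _) (esymmOn_nonneg hf _)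
  | insert a s ha ih =>
    obtain rfl | hlt := hij.eq_or_lt
    · rw [mul_comm]
    obtain ⟨j, rfl⟩ : ∃ m, j = m + 1 := ⟨j - 1, by omega⟩
    have hnn := esymmOn_nonneg (s := s) hf
    have hij' : i ≤ j := by omega
    have h := ih (i := i) (j := j + 1) hij
    have h₁ := ih hij'
    cases i with
    | zero =>
      simp only [esymmOn_insert_succ ha, esymmOn_zero] at *
      nlinarith [mul_nonneg (hf a) (mul_nonneg (hnn 1) (hnn j)),
        mul_nonneg (mul_nonneg (hf a) (hf a)) (hnn j)]
    | succ i =>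
      have h₂ := ih (i := i) (j := j + 1) (by omega)
      have h₃ := ih (i := i) (j := j) (by omega)
      simp only [esymmOn_insert_succ ha]
      have h₄ := mul_le_mul_of_nonneg_left (h₂.trans h₁) (hf a)
      have h₅ := mul_le_mul_of_nonneg_left h₃ (mul_nonneg (hf a) (hf a))
      linear_combination h + h₄ + h₅

end esymmOn

/-- Spreading out two coordinates with a fixed sum, so that their product decreases, increases the
ratio of consecutive elementary symmetric polynomials. -/
lemma esymmOn_ratio_le_of_mul_le {ι : Type*} [DecidableEq ι] {s : Finset ι} {f g : ι → ℝ} {a b : ι}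
    (hab : a ≠ b) (ha : a ∉ s) (hb : b ∉ s) (hf : ∀ i, 0 < f i) (hg : ∀ i, 0 < g i)
    (hfg : ∀ i ∈ s, f i = g i) (hsum : f a + f b = g a + g b) (hmul : f a * f b ≤ g a * g b)
    {k : ℕ} (hk : k + 1 ≤ #s + 2) :
    esymmOn (insert a (insert b s)) k g / esymmOn (insert a (insert b s)) (k + 1) g ≤
      esymmOn (insert a (insert b s)) k f / esymmOn (insert a (insert b s)) (k + 1) f := by
  have ha' : a ∉ insert b s := by simp [hab, ha]
  have hcard : #(insert a (insert b s)) = #s + 2 := by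
    rw [card_insert_of_notMem ha', card_insert_of_notMem hb]
  rw [div_le_div_iff₀ (esymmOn_pos hg (hcard ▸ hk)) (esymmOn_pos hf (hcard ▸ hk))]
  have hnn := esymmOn_nonneg (s := s) fun i => (hf i).le
  have h0 := hf a
  have h1 := hf b
  match k with
  | 0 =>
    simp only [esymmOn_insert_succ ha', esymmOn_insert_succ hb, esymmOn_zero,
      ← esymmOn_congr hfg]
    linarith
  | 1 =>
    simp only [esymmOn_insert_succ ha', esymmOn_insert_succ hb, esymmOn_zero,
      ← esymmOn_congr hfg]
    have hS : g a = f a + f b - g b := by linarith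
    have hA : 0 ≤ esymmOn s (0 + 1) f + (f a + f b) := by linarith [hnn (0 + 1)]
    have := mul_nonneg hA (sub_nonneg.2 hmul)
    rw [hS] at this ⊢
    linear_combination this
  | m + 2 =>
    simp only [esymmOn_insert_succ ha', esymmOn_insert_succ hb, ← esymmOn_congr hfg]
    have h₁ := esymmOn_mul_le (s := s) (fun i => (hf i).le) (Nat.le_add_right m 1)
    have h₂ := esymmOn_mul_le (s := s) (fun i => (hf i).le) (Nat.le_add_right m 2)
    have hS : g a = f a + f b - g b := by linarith
    have hA : 0 ≤ (esymmOn s (m + 1) f * esymmOn s (m + 2) f - esymmOn s m f * esymmOn s (m + 3) f)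
        + (f a + f b) * (esymmOn s (m + 1) f * esymmOn s (m + 1) f
          - esymmOn s m f * esymmOn s (m + 2) f) :=
      add_nonneg (sub_nonneg.2 h₂) (mul_nonneg (by linarith) (sub_nonneg.2 h₁))
    have := mul_nonneg hA (sub_nonneg.2 hmul)
    rw [hS] at this ⊢
    linear_combination this

lemma sum_update_add_update_sub {ι : Type*} [DecidableEq ι] (s : Finset ι) (x : ι → ℝ) {a b : ι}
    (hab : a ≠ b) (δ : ℝ) :
    ∑ i ∈ s, Function.update (Function.update x a (x a - δ)) b (x b + δ) i =
      ∑ i ∈ s, x i - (if a ∈ s then δ else 0) + (if b ∈ s then δ else 0) := by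
  have h : ∀ i, Function.update (Function.update x a (x a - δ)) b (x b + δ) i =
      x i - (if a = i then δ else 0) + (if b = i then δ else 0) := by
    intro i
    by_cases hib : i = b
    · subst hib
      simp [hab]
    · by_cases hia : i = a
      · subst hia
        simp [hab, hab.symm]
      · simp [hia, hib, Ne.symm hia, Ne.symm hib]
  simp_rw [h, sum_add_distrib, sum_sub_distrib, sum_ite_eq]

/-- If the partial sums of the decreasing vector `y` are bounded by those of `x`, with equal total
sums, then `x ≠ y` provides a coordinate `a` where `x` is larger than `y`, followed by a coordinate
`b` where `x` is smaller, with no such smaller coordinate before `b`. -/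
lemma exists_lt_of_partial_sums_le {d : ℕ} {x y : Fin d → ℝ}
    (hmaj : ∀ m : ℕ, ∑ i with (i : Fin d).val < m, y i ≤ ∑ i with (i : Fin d).val < m, x i)
    (htot : ∑ i, y i = ∑ i, x i) (hne : x ≠ y) :
    ∃ a b, a < b ∧ y a < x a ∧ x b < y b ∧ ∀ i < b, y i ≤ x i := by
  have hex : ∃ b, x b < y b := by
    by_contra! h
    exact hne (funext fun i => ((sum_eq_sum_iff_of_le fun i _ => h i).1 htot i (mem_univ i)).symm)
  obtain ⟨b, hb, hmin⟩ := WellFounded.has_min (wellFounded_lt (α := Fin d)) {b | x b < y b} hex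
  have hfirst : ∀ i < b, y i ≤ x i := fun i hi => not_lt.1 fun h => hmin i h hi
  have hea : ∃ a, a < b ∧ y a < x a := by
    by_contra! h
    refine (hmaj (b + 1)).not_gt (sum_lt_sum (fun i hi => ?_) ⟨b, by simp, hb⟩)
    have hib : i ≤ b := Fin.le_def.2 (Nat.lt_succ_iff.1 (mem_filter.1 hi).2)
    obtain rfl | hlt := hib.eq_or_lt
    · exact hb.le
    · exact h i hlt
  obtain ⟨a, hab, ha⟩ := hea
  exact ⟨a, b, hab, ha, hb, hfirst⟩

lemma esymmOn_univ_ratio_le {d k : ℕ} (hk : k + 1 ≤ d) {y : Fin d → ℝ} (hy : Antitone y)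
    (hy0 : ∀ i, 0 < y i) (x : Fin d → ℝ) (hx0 : ∀ i, 0 < x i)
    (hmaj : ∀ m : ℕ, ∑ i with (i : Fin d).val < m, y i ≤ ∑ i with (i : Fin d).val < m, x i)
    (htot : ∑ i, y i = ∑ i, x i) :
    esymmOn univ k y / esymmOn univ (k + 1) y ≤ esymmOn univ k x / esymmOn univ (k + 1) x := by
  induction hn : #{i | x i ≠ y i} using Nat.strong_induction_on generalizing x with
  | _ n ih =>
    obtain rfl | hne := eq_or_ne x y
    · exact le_rfl
    obtain ⟨a, b, hab, ha, hb, hfirst⟩ := exists_lt_of_partial_sums_le hmaj htot hne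
    have hyab := hy hab.le
    set δ := min (x a - y a) (y b - x b) with hδ
    have hδ0 : 0 < δ := lt_min (by linarith) (by linarith)
    have hδa : δ ≤ x a - y a := min_le_left _ _
    have hδb : δ ≤ y b - x b := min_le_right _ _
    set z := Function.update (Function.update x a (x a - δ)) b (x b + δ) with hz
    have hza : z a = x a - δ := by simp [hz, hab.ne]
    have hzb : z b = x b + δ := by simp [hz]
    have hzi : ∀ i, i ≠ a → i ≠ b → z i = x i := fun i h h' => by simp [hz, h, h']
    have hz0 : ∀ i, 0 < z i := by
      intro i
      by_cases hia : i = a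
      · rw [hia, hza]
        linarith [hy0 a]
      by_cases hib : i = b
      · rw [hib, hzb]
        linarith [hx0 b]
      rw [hzi i hia hib]
      exact hx0 i
    have hzsum (s : Finset (Fin d)) := sum_update_add_update_sub s x hab.ne δ
    rw [← hz] at hzsum
    have hcard : #{i | z i ≠ y i} < n := by
      rw [← hn]
      refine card_lt_card (Finset.ssubset_iff_subset_ne.2 ⟨fun i hi => ?_, fun heq => ?_⟩)
      · simp only [mem_filter, mem_univ, true_and] at hi ⊢
        by_cases hia : i = a
        · exact hia ▸ ha.ne'
        by_cases hib : i = b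
        · exact hib ▸ hb.ne
        rwa [hzi i hia hib] at hi
      · have hA : a ∈ ({i | z i ≠ y i} : Finset (Fin d)) := heq ▸ by simpa using ha.ne'
        have hB : b ∈ ({i | z i ≠ y i} : Finset (Fin d)) := heq ▸ by simpa using hb.ne
        simp only [mem_filter, mem_univ, true_and, hza, hzb] at hA hB
        obtain h | h := min_choice (x a - y a) (y b - x b)
        · exact hA (by rw [hδ, h]; ring)
        · exact hB (by rw [hδ, h]; ring)
    have hzmaj (m : ℕ) :
        ∑ i with (i : Fin d).val < m, y i ≤ ∑ i with (i : Fin d).val < m, z i := by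
      rw [hzsum]
      simp only [mem_filter, mem_univ, true_and]
      have hm := hmaj m
      have hab' : a.val < b.val := hab
      by_cases hbm : b.val < m
      · rw [if_pos hbm, if_pos (by omega)]
        linarith
      rw [if_neg hbm]
      by_cases ham : a.val < m
      · rw [if_pos ham]
        have hle := single_le_sum (f := fun i => x i - y i) (s := ({i | i.val < m} : Finset (Fin d)))
          (fun i hi => sub_nonneg.2 (hfirst i (Fin.lt_def.2 (by have := (mem_filter.1 hi).2; omega))))
          (a := a) (by simpa using ham)
        rw [sum_sub_distrib] at hle
        linarith
      · rw [if_neg ham]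
        linarith
    refine (ih _ hcard z hz0 hzmaj (by rw [hzsum]; simpa using htot) rfl).trans ?_
    have huniv : (univ : Finset (Fin d)) = insert a (insert b ((univ.erase a).erase b)) := by
      rw [insert_erase (by simpa using hab.ne'), insert_erase (mem_univ a)]
    have hd : #((univ.erase a).erase b : Finset (Fin d)) + 2 = d := by
      have h := card_fin d
      rw [huniv, card_insert_of_notMem (by simp [hab.ne]), card_insert_of_notMem (by simp)] at h
      exact h
    rw [huniv]
    refine esymmOn_ratio_le_of_mul_le hab.ne (by simp) (by simp) hx0 hz0 (fun i hi => ?_)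
      (by rw [hza, hzb]; ring) ?_ (by omega)
    · simp only [mem_erase, mem_univ, and_true] at hi
      exact (hzi i hi.2 hi.1).symm
    · rw [hza, hzb]
      have := mul_nonneg hδ0.le (by linarith : 0 ≤ x a - x b - δ)
      linarith

theorem esymm_ratio_schur_convex {d k : ℕ} (hk : 1 ≤ k) (hkd : k ≤ d)
    (x y : Fin d → ℝ) (hx : Antitone x) (hy : Antitone y)
    (hx0 : ∀ i, 0 < x i) (hy0 : ∀ i, 0 < y i)
    (hmaj : ∀ m : ℕ, 1 ≤ m → m < d →
      ∑ i ∈ Finset.univ.filter (fun i : Fin d => (i : ℕ) < m), y i ≤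
        ∑ i ∈ Finset.univ.filter (fun i : Fin d => (i : ℕ) < m), x i)
    (htot : ∑ i, y i = ∑ i, x i) :
    esymm (k - 1) y / esymm k y ≤ esymm (k - 1) x / esymm k x := by
  obtain ⟨k, rfl⟩ := Nat.exists_eq_add_of_le' hk
  refine esymmOn_univ_ratio_le hkd hy hy0 x hx0 (fun m => ?_) htot
  obtain rfl | hm := Nat.eq_zero_or_pos m
  · simp
  obtain hmd | hmd := lt_or_ge m d
  · exact hmaj m hm hmd
  · rw [filter_true_of_mem fun i _ => i.isLt.trans_le hmd]
    exact htot.le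
end
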